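/- A positive integer N is the area of a right triangle with positive rational legs if and only if there exist rationals p, q, r such that p², q², r² form an arithmetic progression with common difference N. -/

import Mathlib

theorem stmt_0 (N : ℕ) (hN : 0 < N) :
    (∃ a b h : ℚ, 0 < a ∧ 0 < b ∧ 0 < h ∧ a ^ 2 + b ^ 2 = h ^ 2 ∧ a * b / 2 = N) ↔
    (∃ p q r : ℚ, q ^ 2 - p ^ 2 = N ∧ r ^ 2 - q ^ 2 = N) := by
  have hN' : (0 : ℚ) < N := by exact_mod_cast hN
  constructor
  · rintro ⟨a, b, h, -, -, -, hsq, harea⟩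
    exact ⟨(a - b) / 2, h / 2, (a + b) / 2, by linarith, by linarith⟩
  · rintro ⟨p, q, r, hpq, hqr⟩
    have hpr : |p| < |r| := sq_lt_sq.mp (by linarith)
    have hq : q ≠ 0 := by
      rintro rfl
      linarith [sq_nonneg p]
    have hp2 := sq_abs p
    have hq2 := sq_abs q
    have hr2 := sq_abs r
    exact ⟨|r| - |p|, |r| + |p|, 2 * |q|, sub_pos.mpr hpr,
      by linarith [abs_nonneg p], by positivity, by linarith, by linarith⟩
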